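/- arXiv:2001.09655 — 3 statements merged into one kernel-verified Lean document; each statement's English description precedes it below -/
import Mathlib

section
/- Let h₀ > 0 and let b, ζ : ℝ → ℝ and v, w : ℝ × ℝ → ℝ be continuously differentiable. Assume the incompressibility condition ∂ₓv(x,z) + ∂_z w(x,z) = 0 for all (x,z) ∈ ℝ², and the bottom impermeability condition w(x, −h₀ + b(x)) = b'(x)·v(x, −h₀ + b(x)) for all x. Define the horizontal discharge Q(x) = ∫_{−h₀+b(x)}^{ζ(x)} v(x,z) dz. Then for every x ∈ ℝ one has w(x, ζ(x)) − ζ'(x)·v(x, ζ(x)) = −Q'(x); that is, the normal component of the velocity at the free surface equals minus the derivative of the horizontal discharge. -/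
open Real MeasureTheory

theorem ContDiff.hasDerivAt_prodMk_left {v : ℝ × ℝ → ℝ} (hv : ContDiff ℝ 1 v) (x z : ℝ) :
    HasDerivAt (fun y => v (y, z)) (fderiv ℝ v (x, z) (1, 0)) x :=
  ((hv.differentiable one_ne_zero).differentiableAt (x := (x, z))).hasFDerivAt.comp_hasDerivAt x
    ((hasDerivAt_id x).prodMk (hasDerivAt_const x z))

theorem ContDiff.hasDerivAt_prodMk_right {v : ℝ × ℝ → ℝ} (hv : ContDiff ℝ 1 v) (x z : ℝ) :
    HasDerivAt (fun y => v (x, y)) (fderiv ℝ v (x, z) (0, 1)) z :=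
  ((hv.differentiable one_ne_zero).differentiableAt (x := (x, z))).hasFDerivAt.comp_hasDerivAt z
    ((hasDerivAt_const z x).prodMk (hasDerivAt_id z))

/-- Differentiation under the integral sign with fixed endpoints. -/
theorem ContDiff.hasDerivAt_intervalIntegral_left {v : ℝ × ℝ → ℝ} (hv : ContDiff ℝ 1 v)
    (a c x : ℝ) :
    HasDerivAt (fun y => ∫ z in a..c, v (y, z)) (∫ z in a..c, fderiv ℝ v (x, z) (1, 0)) x := by
  have hc : Continuous v := hv.continuous
  have hc' : Continuous fun p => fderiv ℝ v p (1, 0) :=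
    (hv.continuous_fderiv one_ne_zero).clm_apply continuous_const
  obtain ⟨C, hC⟩ := ((isCompact_closedBall x 1).prod (isCompact_uIcc (a := a) (b := c))
    ).exists_bound_of_continuousOn hc'.continuousOn
  refine (intervalIntegral.hasDerivAt_integral_of_dominated_loc_of_deriv_le
    (F := fun y z => v (y, z)) (F' := fun y z => fderiv ℝ v (y, z) (1, 0))
    (bound := fun _ => C) (Metric.closedBall_mem_nhds x one_pos) ?_ ?_ ?_ ?_ ?_ ?_).2
  · exact .of_forall fun y => (hc.comp (by fun_prop)).aestronglyMeasurable
  · exact (hc.comp (by fun_prop : Continuous fun z => (x, z))).intervalIntegrable _ _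
  · exact (hc'.comp (by fun_prop : Continuous fun z => (x, z))).aestronglyMeasurable
  · exact .of_forall fun z hz y hy => hC (y, z) ⟨hy, Set.uIoc_subset_uIcc hz⟩
  · exact intervalIntegrable_const
  · exact .of_forall fun z _ y _ => hv.hasDerivAt_prodMk_left y z

theorem ContDiff.hasDerivAt_intervalIntegral_upper {v : ℝ × ℝ → ℝ} (hv : ContDiff ℝ 1 v)
    {β : ℝ → ℝ} {β' x : ℝ} (a : ℝ) (hβ : HasDerivAt β β' x) :
    HasDerivAt (fun y => ∫ z in a..β y, v (y, z))
      ((∫ z in a..β x, fderiv ℝ v (x, z) (1, 0)) + β' * v (x, β x)) x := by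
  have hc : Continuous v := hv.continuous
  have hc' : Continuous fun p => fderiv ℝ v p (1, 0) :=
    (hv.continuous_fderiv one_ne_zero).clm_apply continuous_const
  have hstrict := hasStrictFDerivAt_uncurry_coprod (𝕜 := ℝ) (u := (x, β x))
    (f := fun y u => ∫ z in a..u, v (y, z))
    (f₁ := fun y u => ContinuousLinearMap.toSpanSingleton ℝ
      (∫ z in a..u, fderiv ℝ v (y, z) (1, 0)))
    (f₂ := fun y u => ContinuousLinearMap.toSpanSingleton ℝ (v (y, u)))
    (.of_forall fun p => (hv.hasDerivAt_intervalIntegral_left a p.2 p.1).hasFDerivAt)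
    (.of_forall fun p => by
      have hp : Continuous fun z => v (p.1, z) := hc.comp (by fun_prop)
      exact (intervalIntegral.integral_hasDerivAt_right (hp.intervalIntegrable _ _)
        hp.stronglyMeasurable.stronglyMeasurableAtFilter hp.continuousAt).hasFDerivAt)
    (by
      refine Continuous.continuousAt ?_
      exact (ContinuousLinearMap.toSpanSingletonCLE (𝕜 := ℝ) (E := ℝ)).continuous.comp
        (intervalIntegral.continuous_parametric_intervalIntegral_of_continuous
          (f := fun (p : ℝ × ℝ) z => fderiv ℝ v (p.1, z) (1, 0))
          (hc'.comp (by fun_prop : Continuous fun q : (ℝ × ℝ) × ℝ => (q.1.1, q.2)))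
          continuous_snd))
    (by
      refine Continuous.continuousAt ?_
      exact (ContinuousLinearMap.toSpanSingletonCLE (𝕜 := ℝ) (E := ℝ)).continuous.comp hc)
  have h := hstrict.hasFDerivAt.comp_hasDerivAt x ((hasDerivAt_id x).prodMk hβ)
  refine h.congr_deriv ?_
  simp [Function.HasUncurry.uncurry]

/-- **Leibniz integral rule** with variable endpoints. -/
theorem ContDiff.hasDerivAt_intervalIntegral {v : ℝ × ℝ → ℝ} (hv : ContDiff ℝ 1 v)
    {α β : ℝ → ℝ} {α' β' x : ℝ} (hα : HasDerivAt α α' x) (hβ : HasDerivAt β β' x) :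
    HasDerivAt (fun y => ∫ z in α y..β y, v (y, z))
      ((∫ z in α x..β x, fderiv ℝ v (x, z) (1, 0)) + β' * v (x, β x) - α' * v (x, α x)) x := by
  have hi : ∀ y a c, IntervalIntegrable (fun z => v (y, z)) volume a c := fun y a c =>
    (hv.continuous.comp (by fun_prop : Continuous fun z => (y, z))).intervalIntegrable a c
  have hi' : ∀ a c, IntervalIntegrable (fun z => fderiv ℝ v (x, z) (1, 0)) volume a c :=
    fun a c => (((hv.continuous_fderiv one_ne_zero).clm_apply continuous_const).comp
      (by fun_prop : Continuous fun z => (x, z))).intervalIntegrable a c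
  have h := (hv.hasDerivAt_intervalIntegral_upper 0 hβ).sub
    (hv.hasDerivAt_intervalIntegral_upper 0 hα)
  refine (h.congr_of_eventuallyEq (.of_forall fun y => ?_)).congr_deriv ?_
  · exact (intervalIntegral.integral_interval_sub_left (hi y _ _) (hi y _ _)).symm
  · rw [← intervalIntegral.integral_interval_sub_left (hi' 0 (β x)) (hi' 0 (α x))]
    ring

theorem stmt0 (h₀ : ℝ) (hh₀ : 0 < h₀)
    (b ζ : ℝ → ℝ) (hb : ContDiff ℝ 1 b) (hζ : ContDiff ℝ 1 ζ)
    (v w : ℝ × ℝ → ℝ) (hv : ContDiff ℝ 1 v) (hw : ContDiff ℝ 1 w)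
    (incomp : ∀ x z : ℝ,
      deriv (fun x' => v (x', z)) x + deriv (fun z' => w (x, z')) z = 0)
    (bottom : ∀ x : ℝ,
      w (x, -h₀ + b x) = deriv b x * v (x, -h₀ + b x)) :
    ∀ x : ℝ,
      w (x, ζ x) - deriv ζ x * v (x, ζ x)
        = - deriv (fun x' => ∫ z in (-h₀ + b x')..(ζ x'), v (x', z)) x := by
  intro x
  have hα : HasDerivAt (fun y => -h₀ + b y) (deriv b x) x :=
    ((hb.differentiable one_ne_zero).differentiableAt.hasDerivAt).const_add _
  have hβ : HasDerivAt ζ (deriv ζ x) x :=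
    (hζ.differentiable one_ne_zero).differentiableAt.hasDerivAt
  have hflux : ∫ z in (-h₀ + b x)..(ζ x), fderiv ℝ w (x, z) (0, 1)
      = w (x, ζ x) - w (x, -h₀ + b x) :=
    intervalIntegral.integral_eq_sub_of_hasDerivAt
      (fun z _ => hw.hasDerivAt_prodMk_right x z)
      ((((hw.continuous_fderiv one_ne_zero).clm_apply continuous_const).comp
        (by fun_prop : Continuous fun z => (x, z))).intervalIntegrable _ _)
  have hdiv : ∀ z, fderiv ℝ v (x, z) (1, 0) = -fderiv ℝ w (x, z) (0, 1) := fun z => by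
    have h := incomp x z
    rw [(hv.hasDerivAt_prodMk_left x z).deriv, (hw.hasDerivAt_prodMk_right x z).deriv] at h
    linarith
  rw [(hv.hasDerivAt_intervalIntegral hα hβ).deriv]
  simp only [hdiv, intervalIntegral.integral_neg, hflux, bottom]
  ring
end

section
/- Let h₀ > 0, let b : ℝ → ℝ be continuously differentiable, and let ζ : ℝ × ℝ → ℝ (surface elevation) and v, w : ℝ × ℝ × ℝ → ℝ (horizontal and vertical velocity, functions of (t,x,z)) be continuously differentiable. Assume for all (t,x,z): the incompressibility condition ∂ₓv + ∂_z w = 0; the bottom impermeability condition w(t, x, −h₀ + b(x)) = b'(x)·v(t, x, −h₀ + b(x)); and the kinematic surface condition ∂_t ζ(t,x) = w(t,x,ζ(t,x)) − ∂ₓζ(t,x)·v(t,x,ζ(t,x)). Define the horizontal discharge Q(t,x) = ∫_{−h₀+b(x)}^{ζ(t,x)} v(t,x,z) dz. Then the exact mass conservation equation ∂_t ζ(t,x) + ∂ₓ Q(t,x) = 0 holds for all (t,x). -/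
open Real MeasureTheory

/-- Differentiation under the integral sign over a fixed interval. -/
theorem hasDerivAt_intervalIntegral_of_continuous {F F' : ℝ → ℝ → ℝ}
    (hF : Continuous F.uncurry) (hF' : Continuous F'.uncurry)
    (h : ∀ y z, HasDerivAt (fun y' => F y' z) (F' y z) y) (a b x : ℝ) :
    HasDerivAt (fun y => ∫ z in a..b, F y z) (∫ z in a..b, F' x z) x := by
  obtain ⟨C, hC⟩ := ((isCompact_Icc (a := x - 1) (b := x + 1)).prod
    (isCompact_uIcc (a := a) (b := b))).exists_bound_of_continuousOn hF'.continuousOn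
  have hc : ∀ y, Continuous (F y) := fun y => hF.comp (Continuous.prodMk_right y)
  have hc' : ∀ y, Continuous (F' y) := fun y => hF'.comp (Continuous.prodMk_right y)
  refine (intervalIntegral.hasDerivAt_integral_of_dominated_loc_of_deriv_le
    (bound := fun _ => C) (F' := F') (Icc_mem_nhds (sub_one_lt x) (lt_add_one x))
    (.of_forall fun y => (hc y).aestronglyMeasurable) ((hc x).intervalIntegrable a b)
    (hc' x).aestronglyMeasurable ?_ intervalIntegrable_const
    (.of_forall fun z _ y _ => h y z)).2
  exact .of_forall fun z hz y hy => hC (y, z) ⟨hy, Set.uIoc_subset_uIcc hz⟩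

/-- The contribution of a moving endpoint to the derivative of a parametric integral. -/
theorem hasDerivAt_intervalIntegral_moving_endpoint {F : ℝ → ℝ → ℝ}
    (hF : Continuous F.uncurry) {β : ℝ → ℝ} (hβ : Continuous β) {β' x : ℝ}
    (hβ' : HasDerivAt β β' x) :
    HasDerivAt (fun y => ∫ z in β x..β y, F y z) (β' * F x (β x)) x := by
  set K : ℝ → ℝ := fun y => ∫ u in (0 : ℝ)..1, F y (β x + (β y - β x) * u)
  have hK : Continuous K := by
    refine intervalIntegral.continuous_parametric_intervalIntegral_of_continuous' ?_ 0 1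
    exact hF.comp (f := fun p : ℝ × ℝ => (p.1, β x + (β p.1 - β x) * p.2)) (by fun_prop)
  have hKx : K x = F x (β x) := by simp [K]
  have hint : (fun y => ∫ z in β x..β y, F y z) = fun y => (β y - β x) * K y := by
    funext y
    simp [K, intervalIntegral.mul_integral_comp_add_mul]
  rw [hint, ← hKx, hasDerivAt_iff_tendsto_slope]
  refine ((hasDerivAt_iff_tendsto_slope.1 hβ').mul
    (hK.continuousAt.tendsto.mono_left nhdsWithin_le_nhds)).congr fun y => ?_
  simp only [slope_def_field]
  ring

/-- The Leibniz integral rule. -/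
theorem hasDerivAt_intervalIntegral_leibniz {F F' : ℝ → ℝ → ℝ}
    (hF : Continuous F.uncurry) (hF' : Continuous F'.uncurry)
    (h : ∀ y z, HasDerivAt (fun y' => F y' z) (F' y z) y)
    {α β : ℝ → ℝ} (hα : Continuous α) (hβ : Continuous β) {α' β' x : ℝ}
    (hα' : HasDerivAt α α' x) (hβ' : HasDerivAt β β' x) :
    HasDerivAt (fun y => ∫ z in α y..β y, F y z)
      ((∫ z in α x..β x, F' x z) + β' * F x (β x) - α' * F x (α x)) x := by
  have hi : ∀ y a b, IntervalIntegrable (F y) volume a b := fun y a b =>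
    (hF.comp (Continuous.prodMk_right y)).intervalIntegrable a b
  refine (((hasDerivAt_intervalIntegral_of_continuous hF hF' h (α x) (β x) x).add
    (hasDerivAt_intervalIntegral_moving_endpoint hF hβ hβ')).sub
    (hasDerivAt_intervalIntegral_moving_endpoint hF hα hα')).congr_of_eventuallyEq
    (.of_forall fun y => ?_)
  simp only [Pi.add_apply, Pi.sub_apply]
  rw [intervalIntegral.integral_add_adjacent_intervals (hi ..) (hi ..),
    intervalIntegral.integral_interval_sub_left (hi ..) (hi ..)]

theorem stmt1 (h₀ : ℝ) (hh₀ : 0 < h₀)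
    (b : ℝ → ℝ) (hb : ContDiff ℝ 1 b)
    (ζ : ℝ × ℝ → ℝ) (hζ : ContDiff ℝ 1 ζ)
    (v w : ℝ × ℝ × ℝ → ℝ) (hv : ContDiff ℝ 1 v) (hw : ContDiff ℝ 1 w)
    (incomp : ∀ t x z : ℝ,
      deriv (fun x' => v (t, x', z)) x + deriv (fun z' => w (t, x, z')) z = 0)
    (bottom : ∀ t x : ℝ,
      w (t, x, -h₀ + b x) = deriv b x * v (t, x, -h₀ + b x))
    (kinematic : ∀ t x : ℝ,
      deriv (fun s => ζ (s, x)) t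
        = w (t, x, ζ (t, x)) - deriv (fun y => ζ (t, y)) x * v (t, x, ζ (t, x))) :
    ∀ t x : ℝ,
      deriv (fun s => ζ (s, x)) t
        + deriv (fun y => ∫ z in (-h₀ + b y)..(ζ (t, y)), v (t, y, z)) x = 0 := by
  intro t x
  have hv₂ : ∀ y z, HasDerivAt (fun y' => v (t, y', z)) (fderiv ℝ v (t, y, z) (0, 1, 0)) y :=
    fun y z => (hv.differentiable one_ne_zero _).hasFDerivAt.comp_hasDerivAt y
      ((hasDerivAt_const y t).prodMk ((hasDerivAt_id y).prodMk (hasDerivAt_const y z)))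
  have hw₃ : ∀ z, HasDerivAt (fun z' => w (t, x, z')) (-fderiv ℝ v (t, x, z) (0, 1, 0)) z := by
    intro z
    have hd : DifferentiableAt ℝ (fun z' => w (t, x, z')) z :=
      (hw.differentiable one_ne_zero _).comp z (by fun_prop)
    have hdiv := incomp t x z
    rw [(hv₂ x z).deriv] at hdiv
    rw [← eq_neg_of_add_eq_zero_right hdiv]
    exact hd.hasDerivAt
  have hζd : Differentiable ℝ fun y => ζ (t, y) :=
    (hζ.differentiable one_ne_zero).comp (by fun_prop)
  have hbd : Differentiable ℝ b := hb.differentiable one_ne_zero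
  have hF : Continuous (Function.uncurry fun y z => v (t, y, z)) :=
    hv.continuous.comp (f := fun p : ℝ × ℝ => (t, p.1, p.2)) (by fun_prop)
  have hF' : Continuous (Function.uncurry fun y z => fderiv ℝ v (t, y, z) (0, 1, 0)) :=
    ((hv.continuous_fderiv one_ne_zero).comp
      (f := fun p : ℝ × ℝ => (t, p.1, p.2)) (by fun_prop)).clm_apply continuous_const
  have hQ := hasDerivAt_intervalIntegral_leibniz (α := fun y => -h₀ + b y) hF hF' hv₂
    (continuous_const.add hbd.continuous) hζd.continuous
    ((hbd x).hasDerivAt.const_add (-h₀)) (hζd x).hasDerivAt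
  have hFTC : ∫ z in (-h₀ + b x)..(ζ (t, x)), -fderiv ℝ v (t, x, z) (0, 1, 0)
      = w (t, x, ζ (t, x)) - w (t, x, -h₀ + b x) :=
    intervalIntegral.integral_eq_sub_of_hasDerivAt (fun z _ => hw₃ z)
      ((hF'.comp (Continuous.prodMk_right x)).neg.intervalIntegrable _ _)
  rw [intervalIntegral.integral_neg] at hFTC
  rw [hQ.deriv, kinematic]
  linarith [bottom t x]
end

section
/- Let ε > 0, μ > 0 and α > 0, and set c = ε μ^{2α}. Let ζ, v̄, E : ℝ × ℝ → ℝ be continuously differentiable with h := 1 + εζ > 0 everywhere, satisfying the one-dimensional rotational nonlinear shallow water system: ∂_t ζ + ∂ₓ(h v̄) = 0; ∂_t v̄ + ε v̄ ∂ₓ v̄ + ∂ₓ ζ + c (1/h) ∂ₓ E = 0; ∂_t E + ε v̄ ∂ₓ E + 3ε (∂ₓ v̄) E = 0. Then the local energy conservation law ∂_t 𝔢 + ∂ₓ 𝔉 = 0 holds pointwise, with 𝔢 = (1/2)ζ² + (1/2) h v̄² + (μ^{2α}/2) E and 𝔉 = (ζ + (ε/2) v̄²) h v̄ + (3/2) ε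 μ^{2α} v̄ E. -/
open Real

theorem ContDiff.differentiable_slice_left {f : ℝ × ℝ → ℝ} (hf : ContDiff ℝ 1 f) (x : ℝ) :
    Differentiable ℝ fun s => f (s, x) :=
  (hf.differentiable one_ne_zero).comp (differentiable_id.prodMk (differentiable_const x))

theorem ContDiff.differentiable_slice_right {f : ℝ × ℝ → ℝ} (hf : ContDiff ℝ 1 f) (t : ℝ) :
    Differentiable ℝ fun y => f (t, y) :=
  (hf.differentiable one_ne_zero).comp ((differentiable_const t).prodMk differentiable_id)

theorem stmt18 (ε μ α : ℝ) (hε : 0 < ε) (hμ : 0 < μ) (hα : 0 < α)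
    (c : ℝ) (hc : c = ε * μ ^ (2 * α))
    (ζ v E : ℝ × ℝ → ℝ)
    (hζ : ContDiff ℝ 1 ζ) (hv : ContDiff ℝ 1 v) (hE : ContDiff ℝ 1 E)
    (hpos : ∀ t x, 0 < 1 + ε * ζ (t, x))
    (mass : ∀ t x, deriv (fun s => ζ (s, x)) t
      + deriv (fun y => (1 + ε * ζ (t, y)) * v (t, y)) x = 0)
    (mom : ∀ t x, deriv (fun s => v (s, x)) t
      + ε * v (t, x) * deriv (fun y => v (t, y)) x
      + deriv (fun y => ζ (t, y)) x
      + c * (1 / (1 + ε * ζ (t, x))) * deriv (fun y => E (t, y)) x = 0)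
    (ens : ∀ t x, deriv (fun s => E (s, x)) t
      + ε * v (t, x) * deriv (fun y => E (t, y)) x
      + 3 * ε * deriv (fun y => v (t, y)) x * E (t, x) = 0) :
    ∀ t x,
      deriv (fun s =>
          (1/2) * (ζ (s, x))^2 + (1/2) * (1 + ε * ζ (s, x)) * (v (s, x))^2
            + (μ ^ (2 * α) / 2) * E (s, x)) t
        + deriv (fun y =>
            (ζ (t, y) + (ε/2) * (v (t, y))^2) * (1 + ε * ζ (t, y)) * v (t, y)
              + (3/2) * ε * μ ^ (2 * α) * v (t, y) * E (t, y)) x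
        = 0 := by
  intro t x
  have ζt := (hζ.differentiable_slice_left x t).hasDerivAt
  have vt := (hv.differentiable_slice_left x t).hasDerivAt
  have Et := (hE.differentiable_slice_left x t).hasDerivAt
  have ζx := (hζ.differentiable_slice_right t x).hasDerivAt
  have vx := (hv.differentiable_slice_right t x).hasDerivAt
  have Ex := (hE.differentiable_slice_right t x).hasDerivAt
  have energy_t := (((ζt.fun_pow 2).const_mul (1/2)).fun_add
    ((((ζt.const_mul ε).const_add 1).const_mul (1/2)).fun_mul (vt.fun_pow 2))).fun_add
    (Et.const_mul (μ ^ (2 * α) / 2))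
  have flux_x := (((ζx.fun_add ((vx.fun_pow 2).const_mul (ε/2))).fun_mul
    ((ζx.const_mul ε).const_add 1)).fun_mul vx).fun_add
    ((vx.const_mul ((3/2) * ε * μ ^ (2 * α))).fun_mul Ex)
  have momentum_x := ((ζx.const_mul ε).const_add 1).fun_mul vx
  have hmass := mass t x
  have hmom := mom t x
  have hens := ens t x
  rw [momentum_x.deriv] at hmass
  have hh : (1 + ε * ζ (t, x)) * (1 / (1 + ε * ζ (t, x))) = 1 :=
    mul_one_div_cancel (hpos t x).ne'
  rw [energy_t.deriv, flux_x.deriv]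
  subst hc
  push_cast
  linear_combination (ζ (t, x) + ε / 2 * v (t, x) ^ 2) * hmass
    + (1 + ε * ζ (t, x)) * v (t, x) * hmom + μ ^ (2 * α) / 2 * hens
    - ε * μ ^ (2 * α) * v (t, x) * deriv (fun y => E (t, y)) x * hh
end
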